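/- Let P be a positive counter-diagonal 3×3 real matrix. Then there exist invertible diagonal 3×3 real matrices C and D and a real number f > 0 such that C·P·D equals the standard trigonal matrix C³_f, and moreover f³ = (P₀₁·P₁₂·P₂₀)/(P₀₂·P₁₀·P₂₁) (i.e., f is the positive cube root of this ratio). -/

import Mathlib

open Matrix

/-- A 3×3 real matrix is positive counter-diagonal if its diagonal entries vanish
and its off-diagonal entries are positive. -/
def IsPosCounterDiag (P : Matrix (Fin 3) (Fin 3) ℝ) : Prop :=
  (∀ i, P i i = 0) ∧ ∀ i j, i ≠ j → 0 < P i j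

/-- The standard trigonal matrix `C³_f`. -/
def stdTrigonal (f : ℝ) : Matrix (Fin 3) (Fin 3) ℝ :=
  !![0, f, 1; 1, 0, f; f, 1, 0]

theorem stmt_0 (P : Matrix (Fin 3) (Fin 3) ℝ) (hP : IsPosCounterDiag P) :
    ∃ (c d : Fin 3 → ℝ) (f : ℝ),
      (∀ i, c i ≠ 0) ∧ (∀ i, d i ≠ 0) ∧ 0 < f ∧
      Matrix.diagonal c * P * Matrix.diagonal d = stdTrigonal f ∧
      f ^ 3 = (P 0 1 * P 1 2 * P 2 0) / (P 0 2 * P 1 0 * P 2 1) := by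
  obtain ⟨hdiag, hpos⟩ := hP
  have h₀₁ : 0 < P 0 1 := hpos 0 1 (by decide)
  have h₀₂ : 0 < P 0 2 := hpos 0 2 (by decide)
  have h₁₀ : 0 < P 1 0 := hpos 1 0 (by decide)
  have h₁₂ : 0 < P 1 2 := hpos 1 2 (by decide)
  have h₂₀ : 0 < P 2 0 := hpos 2 0 (by decide)
  have h₂₁ : 0 < P 2 1 := hpos 2 1 (by decide)
  obtain ⟨f, hf, hf3⟩ : ∃ f : ℝ, 0 < f ∧
      f ^ 3 = (P 0 1 * P 1 2 * P 2 0) / (P 0 2 * P 1 0 * P 2 1) := by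
    have hr : 0 < (P 0 1 * P 1 2 * P 2 0) / (P 0 2 * P 1 0 * P 2 1) := by positivity
    exact ⟨_, Real.rpow_pos_of_pos hr ((3 : ℕ) : ℝ)⁻¹,
      Real.rpow_inv_natCast_pow hr.le three_ne_zero⟩
  have hcube : f ^ 3 * (P 0 2 * P 1 0 * P 2 1) = P 0 1 * P 1 2 * P 2 0 := by
    rw [hf3, div_mul_cancel₀ _ (by positivity)]
  refine ⟨![1, f * P 0 2 / P 1 2, P 0 1 / (f * P 2 1)],
    ![P 1 2 / (f * P 0 2 * P 1 0), f / P 0 1, 1 / P 0 2], f, ?_, ?_, hf, ?_, hf3⟩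
  · intro i
    fin_cases i <;> simp <;> grind
  · intro i
    fin_cases i <;> simp <;> grind
  · ext i j
    rw [mul_diagonal, diagonal_mul]
    fin_cases i <;> fin_cases j <;> simp [stdTrigonal, hdiag] <;> field_simp
    linarith
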